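/- arXiv:2110.05998 — 2 statements merged into one kernel-verified Lean document; each statement's English description precedes it below -/
import Mathlib

section
/- Let K be ℝ or ℂ and n, m positive integers with 2m ≤ n. Consider the polynomial map T = T_{n,m} on V = (Mat_n(K))³ given by T(X,Y,Z) = (X, Ŷ, Z) with ŷ_{k,l} = y_{k,l} + Σ_{i=1}^{m} x_{k,i} z_{n−m+i,l}, and identify V with K^{3n²} via the coordinates x_{i,j}, y_{i,j}, z_{i,j} (i,j = 1,…,n). Let C be the constant antisymmetric 3n² × 3n² matrix (indexed by these coordinates) whose only nonzero entries are C(y_{p,j}, z_{p,j}) = 1 = −C(z_{p,j}, y_{p,j}) for p = 1,…,n−m, j = 1,…,n, and C(y_{n−m+q,j}, x_{j,m+q}) = 1 = −C(x_{j,m+q}, y_{n−m+q,j}) for q = 1,…,m, j = 1,…,n. Then the Poisson bracket determined by C is invariant under T; equivalently, at every point v ∈ V the Jacobian matrix J(v) of T satisfies J(v) · C · J(v)ᵀ = C. -/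
open Matrix

/-- The tetrahedron map `T_{n,m}` of the paper, viewed as a map on `K^{3n²}`,
with coordinates indexed by `Fin 3 × Fin n × Fin n` (which of the three matrices,
row, column).  Coordinate `(1,k,l)` (the `y`-entry) is sent to
`y_{k,l} + Σ_{i<m} x_{k,i} z_{n-m+i,l}`, the other coordinates are unchanged. -/
def tetraPolyMap (K : Type*) [RCLike K] (n m : ℕ) (hmn : m ≤ n) :
    ((Fin 3 × Fin n × Fin n) → K) → ((Fin 3 × Fin n × Fin n) → K) :=
  fun u a =>
    if a.1 = 1 then
      u a + ∑ i : Fin m,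
        u (0, a.2.1, ⟨i.1, lt_of_lt_of_le i.isLt hmn⟩) *
          u (2, ⟨n - m + i.1, by have := i.isLt; omega⟩, a.2.2)
    else u a

/-- The constant antisymmetric matrix `C` of Theorem `emnmc1`:
its only nonzero entries are `C(y_{p,j}, z_{p,j}) = 1 = -C(z_{p,j}, y_{p,j})`
for `p < n-m` (0-based) and `C(y_{n-m+q,j}, x_{j,m+q}) = 1 = -C(x_{j,m+q}, y_{n-m+q,j})`
for `q < m` (0-based). -/
def tetraPoisson (K : Type*) [RCLike K] (n m : ℕ) :
    Matrix (Fin 3 × Fin n × Fin n) (Fin 3 × Fin n × Fin n) K :=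
  Matrix.of fun a b =>
    (if a.1 = 1 ∧ b.1 = 2 ∧ a.2 = b.2 ∧ (a.2.1 : ℕ) < n - m then (1 : K) else 0)
    + (if a.1 = 2 ∧ b.1 = 1 ∧ a.2 = b.2 ∧ (a.2.1 : ℕ) < n - m then -1 else 0)
    + (if a.1 = 1 ∧ b.1 = 0 ∧ a.2.2 = b.2.1 ∧ n - m ≤ (a.2.1 : ℕ) ∧
          (b.2.2 : ℕ) + n = (a.2.1 : ℕ) + 2 * m then 1 else 0)
    + (if a.1 = 0 ∧ b.1 = 1 ∧ a.2.1 = b.2.2 ∧ n - m ≤ (b.2.1 : ℕ) ∧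
          (a.2.2 : ℕ) + n = (b.2.1 : ℕ) + 2 * m then -1 else 0)

theorem tetraPoisson_transpose (K : Type*) [RCLike K] (n m : ℕ) :
    (tetraPoisson K n m)ᵀ = -tetraPoisson K n m := by
  ext ⟨a, i, j⟩ ⟨b, k, l⟩
  fin_cases a <;> fin_cases b <;> simp [tetraPoisson] <;> grind

/-- The coordinates `x_{k,i}` with `i < m` are Casimir functions. -/
theorem tetraPoisson_x_row (K : Type*) [RCLike K] {n m : ℕ} (k i : Fin n) (hi : (i : ℕ) < m)
    (c : Fin 3 × Fin n × Fin n) : tetraPoisson K n m (0, k, i) c = 0 := by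
  obtain ⟨c, p, q⟩ := c
  simp only [tetraPoisson, Matrix.of_apply]
  simp
  intros
  omega

/-- The coordinates `z_{i,l}` in the last `m` rows are Casimir functions. -/
theorem tetraPoisson_z_row (K : Type*) [RCLike K] {n m : ℕ} (i l : Fin n) (hi : n - m ≤ (i : ℕ))
    (c : Fin 3 × Fin n × Fin n) : tetraPoisson K n m (2, i, l) c = 0 := by
  obtain ⟨c, p, q⟩ := c
  simp only [tetraPoisson, Matrix.of_apply]
  simp
  intros
  omega

/-- The difference between the Jacobian matrix of `tetraPolyMap` and the identity. -/
def tetraJacobianSubOne (K : Type*) [RCLike K] (n m : ℕ) (hmn : m ≤ n)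
    (v : (Fin 3 × Fin n × Fin n) → K) :
    Matrix (Fin 3 × Fin n × Fin n) (Fin 3 × Fin n × Fin n) K :=
  Matrix.of fun a b =>
    if a.1 = 1 then
      ∑ i : Fin m,
        (v (0, a.2.1, ⟨i.1, lt_of_lt_of_le i.isLt hmn⟩) *
            (Pi.single b 1 : (Fin 3 × Fin n × Fin n) → K)
              (2, ⟨n - m + i.1, by have := i.isLt; omega⟩, a.2.2) +
          v (2, ⟨n - m + i.1, by have := i.isLt; omega⟩, a.2.2) *
            (Pi.single b 1 : (Fin 3 × Fin n × Fin n) → K)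
              (0, a.2.1, ⟨i.1, lt_of_lt_of_le i.isLt hmn⟩))
    else 0

theorem jacobian_tetraPolyMap (K : Type*) [RCLike K] (n m : ℕ) (hmn : m ≤ n)
    (v : (Fin 3 × Fin n × Fin n) → K) :
    (Matrix.of fun a b =>
      fderiv K (fun u => tetraPolyMap K n m hmn u a) v (Pi.single b 1)) =
      1 + tetraJacobianSubOne K n m hmn v := by
  ext a b
  have hproj (c : Fin 3 × Fin n × Fin n) :
      HasFDerivAt (fun u : (Fin 3 × Fin n × Fin n) → K => u c)
        (ContinuousLinearMap.proj (R := K) (φ := fun _ => K) c) v :=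
    hasFDerivAt_apply c v
  by_cases ha : a.1 = 1
  · have h := (hproj a).add (HasFDerivAt.fun_sum (u := Finset.univ) fun (i : Fin m) _ =>
      (hproj (0, a.2.1, ⟨i.1, lt_of_lt_of_le i.isLt hmn⟩)).mul
        (hproj (2, ⟨n - m + i.1, by have := i.isLt; omega⟩, a.2.2)))
    have hf : (fun u => tetraPolyMap K n m hmn u a) = _ :=
      funext fun u => by rw [tetraPolyMap, if_pos ha]
    rw [Matrix.of_apply, hf]
    erw [h.fderiv]
    simp [tetraJacobianSubOne, ha, Matrix.one_apply, Pi.single_apply]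
  · have hf : (fun u => tetraPolyMap K n m hmn u a) = fun u => u a :=
      funext fun u => by rw [tetraPolyMap, if_neg ha]
    rw [Matrix.of_apply, hf, (hproj a).fderiv]
    simp [tetraJacobianSubOne, ha, Matrix.one_apply, Pi.single_apply]

theorem tetraJacobianSubOne_mul_tetraPoisson (K : Type*) [RCLike K] (n m : ℕ) (hmn : m ≤ n)
    (v : (Fin 3 × Fin n × Fin n) → K) :
    tetraJacobianSubOne K n m hmn v * tetraPoisson K n m = 0 := by
  ext a c
  rw [Matrix.mul_apply, Matrix.zero_apply]
  refine Finset.sum_eq_zero fun b _ => ?_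
  simp only [tetraJacobianSubOne, Matrix.of_apply]
  split_ifs
  · rw [Finset.sum_mul]
    refine Finset.sum_eq_zero fun i _ => ?_
    simp only [Pi.single_apply, add_mul, mul_ite, ite_mul, mul_one, mul_zero, zero_mul]
    split_ifs with hz hx hx
    · simp [← hz] at hx
    · rw [← hz, tetraPoisson_z_row K _ _ (by simp)]
      simp
    · rw [← hx, tetraPoisson_x_row K _ _ (by simp)]
      simp
    · simp
  · simp

theorem stmt_9 (K : Type*) [RCLike K] (n m : ℕ) (hn : 0 < n) (hm : 1 ≤ m)
    (h2m : 2 * m ≤ n) (v : (Fin 3 × Fin n × Fin n) → K) :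
    (Matrix.of fun a b =>
        fderiv K (fun u => tetraPolyMap K n m (by omega) u a) v (Pi.single b 1)) *
      tetraPoisson K n m *
      (Matrix.of fun a b =>
        fderiv K (fun u => tetraPolyMap K n m (by omega) u a) v (Pi.single b 1))ᵀ =
    tetraPoisson K n m := by
  have hN := tetraJacobianSubOne_mul_tetraPoisson K n m (by omega) v
  have hN' : tetraPoisson K n m * (tetraJacobianSubOne K n m (by omega) v)ᵀ = 0 := by
    have h := congrArg Matrix.transpose hN
    rwa [Matrix.transpose_mul, tetraPoisson_transpose, Matrix.neg_mul, Matrix.transpose_zero,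
      neg_eq_zero] at h
  rw [jacobian_tetraPolyMap, add_mul, one_mul, hN, add_zero, Matrix.transpose_add,
    Matrix.transpose_one, mul_add, mul_one, hN', add_zero]
end

section
/- Let K be ℝ or ℂ and n, m positive integers with 3n ≤ 2m and m ≤ 2n−1. Consider the polynomial map T = T̃_{n,m} on V = (Mat_n(K))³ given by T(X,Y,Z) = (X, Ŷ, Z) with ŷ_{k,l} = y_{k,l} + Σ_{i=1}^{2n−m} x_{k,m−n+i} z_{i,l}, and identify V with K^{3n²} via the coordinates x_{i,j}, y_{i,j}, z_{i,j} (i,j = 1,…,n). Let C be the constant antisymmetric 3n² × 3n² matrix whose only nonzero entries are C(y_{p,j}, z_{2n−m+p,j}) = 1 = −C(z_{2n−m+p,j}, y_{p,j}) for p = 1,…,m−n, j = 1,…,n, and C(y_{m−n+q,j}, x_{j,q}) = 1 = −C(x_{j,q}, y_{m−n+q,j}) for q = 1,…,2n−m, j = 1,…,n. Then the Poisson bracket determined by C is invariant under T; equivalently, at every point v ∈ V the Jacobian matrix J(v) of T satisfies J(v) · C · J(v)ᵀ = C. -/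
open Matrix

/-- The tetrahedron map `T̃_{n,m}` of the paper, viewed as a map on `K^{3n²}`,
with coordinates indexed by `Fin 3 × Fin n × Fin n` (which of the three matrices,
row, column).  Coordinate `(1,k,l)` (the `y`-entry) is sent to
`y_{k,l} + Σ_{i<2n-m} x_{k,m-n+i} z_{i,l}`, the other coordinates are unchanged. -/
def tetraPolyMap2 (K : Type*) [RCLike K] (n m : ℕ) (hnm : n ≤ m) :
    ((Fin 3 × Fin n × Fin n) → K) → ((Fin 3 × Fin n × Fin n) → K) :=
  fun u a =>
    if a.1 = 1 then
      u a + ∑ i : Fin (2 * n - m),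
        u (0, a.2.1, ⟨m - n + i.1, by have := i.isLt; omega⟩) *
          u (2, ⟨i.1, by have := i.isLt; omega⟩, a.2.2)
    else u a

/-- The constant antisymmetric matrix `C` of Theorem `emnmc2`:
its only nonzero entries are `C(y_{p,j}, z_{2n-m+p,j}) = 1 = -C(z_{2n-m+p,j}, y_{p,j})`
for `p < m-n` (0-based) and `C(y_{m-n+q,j}, x_{j,q}) = 1 = -C(x_{j,q}, y_{m-n+q,j})`
for `q < 2n-m` (0-based). -/
def tetraPoisson2 (K : Type*) [RCLike K] (n m : ℕ) :
    Matrix (Fin 3 × Fin n × Fin n) (Fin 3 × Fin n × Fin n) K :=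
  Matrix.of fun a b =>
    (if a.1 = 1 ∧ b.1 = 2 ∧ a.2.2 = b.2.2 ∧ (a.2.1 : ℕ) < m - n ∧
        (b.2.1 : ℕ) + m = 2 * n + (a.2.1 : ℕ) then (1 : K) else 0)
    + (if a.1 = 2 ∧ b.1 = 1 ∧ a.2.2 = b.2.2 ∧ (b.2.1 : ℕ) < m - n ∧
        (a.2.1 : ℕ) + m = 2 * n + (b.2.1 : ℕ) then -1 else 0)
    + (if a.1 = 1 ∧ b.1 = 0 ∧ a.2.2 = b.2.1 ∧ m - n ≤ (a.2.1 : ℕ) ∧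
        (b.2.2 : ℕ) + m = (a.2.1 : ℕ) + n then 1 else 0)
    + (if a.1 = 0 ∧ b.1 = 1 ∧ a.2.1 = b.2.2 ∧ m - n ≤ (b.2.1 : ℕ) ∧
        (a.2.2 : ℕ) + m = (b.2.1 : ℕ) + n then -1 else 0)

/-- The differential of the tetrahedron map fixes every vector whose `x`-entries in the last
`2n - m` columns and `z`-entries in the first `2n - m` rows vanish. -/
lemma fderiv_tetraPolyMap2_apply_of_eq_zero {K : Type*} [RCLike K] {n m : ℕ} (hnm : n ≤ m)
    (v w : (Fin 3 × Fin n × Fin n) → K)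
    (hx : ∀ k c : Fin n, m - n ≤ (c : ℕ) → w (0, k, c) = 0)
    (hz : ∀ r l : Fin n, (r : ℕ) < 2 * n - m → w (2, r, l) = 0)
    (a : Fin 3 × Fin n × Fin n) :
    fderiv K (fun u => tetraPolyMap2 K n m hnm u a) v w = w a := by
  have hproj (c : Fin 3 × Fin n × Fin n) : HasFDerivAt
      (fun u : (Fin 3 × Fin n × Fin n) → K => u c) (ContinuousLinearMap.proj (R := K) c) v :=
    hasFDerivAt_apply c v
  by_cases ha : a.1 = 1
  · simp only [tetraPolyMap2, if_pos ha]
    rw [((hproj a).fun_add (HasFDerivAt.fun_sum fun i _ => (hproj _).fun_mul (hproj _))).fderiv]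
    simp [hx, hz]
  · simp only [tetraPolyMap2, if_neg ha]
    rw [(hproj a).fderiv]
    rfl

/-- Left multiplication by the Jacobian matrix of a scalar-valued family applies the
differentials to the columns. -/
lemma of_fderiv_single_mul_apply {K ι κ μ : Type*} [RCLike K] [Fintype ι] [DecidableEq ι]
    (f : κ → (ι → K) → K) (v : ι → K) (A : Matrix ι μ K) (a : κ) (b : μ) :
    ((Matrix.of fun a c => fderiv K (f a) v (Pi.single c 1)) * A) a b =
      fderiv K (f a) v (fun c => A c b) := by
  conv_rhs => rw [pi_eq_sum_univ' (fun c => A c b)]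
  simp [Matrix.mul_apply, mul_comm]

lemma transpose_tetraPoisson2 (K : Type*) [RCLike K] (n m : ℕ) :
    (tetraPoisson2 K n m)ᵀ = -tetraPoisson2 K n m := by
  ext ⟨a, i, j⟩ ⟨b, k, l⟩
  fin_cases a <;> fin_cases b <;>
    simp [tetraPoisson2, eq_comm, apply_ite (Neg.neg : K → K)]

lemma tetraPoisson2_x_eq_zero (K : Type*) [RCLike K] {n m : ℕ} (h3n : 3 * n ≤ 2 * m)
    (b : Fin 3 × Fin n × Fin n) (k c : Fin n) (hc : m - n ≤ (c : ℕ)) :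
    tetraPoisson2 K n m (0, k, c) b = 0 := by
  have := b.2.1.isLt
  simp [tetraPoisson2]
  omega

lemma tetraPoisson2_z_eq_zero (K : Type*) [RCLike K] {n m : ℕ}
    (b : Fin 3 × Fin n × Fin n) (r l : Fin n) (hr : (r : ℕ) < 2 * n - m) :
    tetraPoisson2 K n m (2, r, l) b = 0 := by
  simp [tetraPoisson2]
  omega

theorem stmt_10 (K : Type*) [RCLike K] (n m : ℕ) (hn : 0 < n) (hm : 1 ≤ m)
    (h3n : 3 * n ≤ 2 * m) (hm2 : m ≤ 2 * n - 1) (v : (Fin 3 × Fin n × Fin n) → K) :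
    (Matrix.of fun a b =>
        fderiv K (fun u => tetraPolyMap2 K n m (by omega) u a) v (Pi.single b 1)) *
      tetraPoisson2 K n m *
      (Matrix.of fun a b =>
        fderiv K (fun u => tetraPolyMap2 K n m (by omega) u a) v (Pi.single b 1))ᵀ =
    tetraPoisson2 K n m := by
  set J : Matrix (Fin 3 × Fin n × Fin n) (Fin 3 × Fin n × Fin n) K := Matrix.of fun a b =>
    fderiv K (fun u => tetraPolyMap2 K n m (by omega) u a) v (Pi.single b 1) with hJ
  have hJC : J * tetraPoisson2 K n m = tetraPoisson2 K n m := by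
    ext a b
    rw [hJ, of_fderiv_single_mul_apply (fun a u => tetraPolyMap2 K n m (by omega) u a)]
    exact fderiv_tetraPolyMap2_apply_of_eq_zero _ v _
      (tetraPoisson2_x_eq_zero K h3n b) (tetraPoisson2_z_eq_zero K b) a
  rw [hJC, ← Matrix.transpose_inj, Matrix.transpose_mul, Matrix.transpose_transpose,
    transpose_tetraPoisson2, Matrix.mul_neg, hJC]
end
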